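/- arXiv:1905.10122 — 2 statements merged into one kernel-verified Lean document; each statement's English description precedes it below -/
import Mathlib

section
/- Let x, y, z be real numbers with 0 < x < y < z. Then ∫ s dξ_{x,y,z}(s) = x² and ∫ s² dξ_{x,y,z}(s) = x²y². -/
open MeasureTheory

noncomputable def psi0 (x y z : ℝ) : ℝ := -(x^2 * y^2 * (z^2 - y^2) / (y^2 - x^2))

noncomputable def psi1 (x y z : ℝ) : ℝ := y^2 * (z^2 - x^2) / (y^2 - x^2)

noncomputable def s0 (x y z : ℝ) : ℝ :=
  (psi1 x y z - Real.sqrt ((psi1 x y z)^2 + 4 * psi0 x y z)) / 2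

noncomputable def s1 (x y z : ℝ) : ℝ :=
  (psi1 x y z + Real.sqrt ((psi1 x y z)^2 + 4 * psi0 x y z)) / 2

noncomputable def rho (x y z : ℝ) : ℝ := (s1 x y z - x^2) / (s1 x y z - s0 x y z)

/-- The Berger measure associated with the Stampfli completion of `(x,y,z)`. -/
noncomputable def xi (x y z : ℝ) : Measure ℝ :=
  ENNReal.ofReal (rho x y z) • Measure.dirac (s0 x y z) +
    ENNReal.ofReal (1 - rho x y z) • Measure.dirac (s1 x y z)

theorem sq_mul_psi1_add_psi0 {x y : ℝ} (z : ℝ) (hx : 0 < x) (hxy : x < y) :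
    x^2 * psi1 x y z + psi0 x y z = x^2 * y^2 := by
  have h : y^2 - x^2 ≠ 0 := by nlinarith
  unfold psi1 psi0
  field_simp
  ring

theorem abs_two_mul_sq_sub_psi1_lt_sqrt {x y : ℝ} (z : ℝ) (hx : 0 < x) (hxy : x < y) :
    |2 * x^2 - psi1 x y z| < √((psi1 x y z)^2 + 4 * psi0 x y z) := by
  have h := sq_mul_psi1_add_psi0 z hx hxy
  have hpos : 0 < x^2 * (y^2 - x^2) := mul_pos (by positivity) (by nlinarith)
  apply Real.lt_sqrt_of_sq_lt
  rw [sq_abs]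
  nlinarith

theorem s0_lt_sq {x y : ℝ} (z : ℝ) (hx : 0 < x) (hxy : x < y) : s0 x y z < x^2 := by
  have h := (abs_lt.mp (abs_two_mul_sq_sub_psi1_lt_sqrt z hx hxy)).1
  unfold s0
  linarith

theorem sq_lt_s1 {x y : ℝ} (z : ℝ) (hx : 0 < x) (hxy : x < y) : x^2 < s1 x y z := by
  have h := (abs_lt.mp (abs_two_mul_sq_sub_psi1_lt_sqrt z hx hxy)).2
  unfold s1
  linarith

theorem s0_add_s1 (x y z : ℝ) : s0 x y z + s1 x y z = psi1 x y z := by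
  unfold s0 s1
  ring

theorem s0_mul_s1 {x y : ℝ} (z : ℝ) (hx : 0 < x) (hxy : x < y) :
    s0 x y z * s1 x y z = -psi0 x y z := by
  have hpos := (abs_nonneg _).trans_lt (abs_two_mul_sq_sub_psi1_lt_sqrt z hx hxy)
  have h := Real.sq_sqrt (Real.sqrt_pos.mp hpos).le
  unfold s0 s1
  linear_combination -h / 4

theorem rho_mem_Icc {x y : ℝ} (z : ℝ) (hx : 0 < x) (hxy : x < y) :
    rho x y z ∈ Set.Icc 0 1 := by
  have h0 := s0_lt_sq z hx hxy
  have h1 := sq_lt_s1 z hx hxy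
  refine ⟨div_nonneg (by linarith) (by linarith), ?_⟩
  exact (div_le_one (by linarith)).mpr (by linarith)

theorem integral_xi {x y : ℝ} (z : ℝ) (hx : 0 < x) (hxy : x < y) (f : ℝ → ℝ) :
    ∫ s, f s ∂(xi x y z) = rho x y z * f (s0 x y z) + (1 - rho x y z) * f (s1 x y z) := by
  obtain ⟨h0, h1⟩ := rho_mem_Icc z hx hxy
  have hint (c a : ℝ) : Integrable f (ENNReal.ofReal c • Measure.dirac a) :=
    (integrable_dirac (by simp)).smul_measure ENNReal.ofReal_ne_top
  rw [xi, integral_add_measure (hint _ _) (hint _ _)]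
  simp [integral_smul_measure, h0, sub_nonneg.mpr h1]

theorem stmt3 (x y z : ℝ) (hx : 0 < x) (hxy : x < y) (hyz : y < z) :
    (∫ s, s ∂(xi x y z) = x^2) ∧ (∫ s, s^2 ∂(xi x y z) = x^2 * y^2) := by
  rw [integral_xi z hx hxy, integral_xi z hx hxy]
  have hrho : rho x y z * (s1 x y z - s0 x y z) = s1 x y z - x^2 :=
    div_mul_cancel₀ _ (by linarith [s0_lt_sq z hx hxy, sq_lt_s1 z hx hxy])
  have hadd := s0_add_s1 x y z
  have hmul := s0_mul_s1 z hx hxy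
  have hpsi := sq_mul_psi1_add_psi0 z hx hxy
  constructor
  · linear_combination -hrho
  · linear_combination -(s0 x y z + s1 x y z) * hrho + x^2 * hadd - hmul + hpsi
end

section
/- Let η ≥ 2 be a natural number, let λ₀ > 0 and let λ_{1,1},…,λ_{η,1} and λ_{1,2},…,λ_{η,2} be positive real numbers. Then the following are equivalent: (a) there exist Borel probability measures μ_1,…,μ_η on ℝ, each of which is either a Dirac measure δ_c with c > 0 or of the form t·δ_a + (1−t)·δ_b with 0 < a < b and 0 < t < 1, such that ∫ s dμ_i(s) = λ_{i,2}² for every i, Σ_{i=1}^{η} λ_{i,1}² ∫ (1/s) dμ_i(s) = 1, and Σ_{i=1}^{η} λ_{i,1}² ∫ (1/s²) dμ_i(s) ≤ 1/λ₀²; (b) there exist real numbers r_1,…,r_η ∈ [1,∞) such that Σ_{i=1}^{η} r_i·λ_{i,1}²/λ_{i,2}² = 1 and Σ_{i=1}^{η} r_i²·λ_{i,1}²/λ_{i,2}⁴ ≤ 1/λ₀² if r_i = 1 for every i, while Σ_{i=1}^{η} r_i²·λ_{i,1}²/λ_{i,2}⁴ < 1/λ₀² if r_i > 1 for some i. Moreover,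 the r_i in (b) can be chosen so that r_i = 1 exactly when μ_i is a Dirac measure and r_i > 1 exactly when μ_i has two atoms. -/
open MeasureTheory

/-- The 2-atomic probability measure `t·δ_a + (1−t)·δ_b`. -/
noncomputable def mu2 (t a b : ℝ) : Measure ℝ :=
  ENNReal.ofReal t • Measure.dirac a + ENNReal.ofReal (1 - t) • Measure.dirac b

/-- `μ` is a Dirac measure at a positive point. -/
def IsOneAtom (μ : Measure ℝ) : Prop := ∃ c : ℝ, 0 < c ∧ μ = Measure.dirac c

/-- `μ` is of the form `t·δ_a + (1−t)·δ_b` with `0 < a < b`, `0 < t < 1`. -/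
def IsTwoAtom (μ : Measure ℝ) : Prop :=
  ∃ t a b : ℝ, 0 < t ∧ t < 1 ∧ 0 < a ∧ a < b ∧ μ = mu2 t a b

theorem integral_mu2 {t a b : ℝ} (ht0 : 0 ≤ t) (ht1 : t ≤ 1) (f : ℝ → ℝ) :
    ∫ s, f s ∂(mu2 t a b) = t * f a + (1 - t) * f b := by
  unfold mu2
  rw [integral_add_measure, integral_smul_measure, integral_smul_measure, integral_dirac,
    integral_dirac, ENNReal.toReal_ofReal ht0, ENNReal.toReal_ofReal (sub_nonneg.2 ht1)]
  · simp
  · exact (integrable_dirac (by simp)).smul_measure ENNReal.ofReal_ne_top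
  · exact (integrable_dirac (by simp)).smul_measure ENNReal.ofReal_ne_top

theorem IsOneAtom.moments {μ : Measure ℝ} (h : IsOneAtom μ) :
    (∫ s, s ∂μ) * ∫ s, 1 / s ∂μ = 1 ∧ ∫ s, 1 / s ^ 2 ∂μ = (∫ s, 1 / s ∂μ) ^ 2 := by
  obtain ⟨c, hc, rfl⟩ := h
  simp only [integral_dirac]
  constructor <;> field_simp

theorem IsTwoAtom.moments {μ : Measure ℝ} (h : IsTwoAtom μ) :
    1 < (∫ s, s ∂μ) * ∫ s, 1 / s ∂μ ∧ (∫ s, 1 / s ∂μ) ^ 2 < ∫ s, 1 / s ^ 2 ∂μ := by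
  obtain ⟨t, a, b, ht0, ht1, ha, hab, rfl⟩ := h
  have hb : 0 < b := ha.trans hab
  have ht : 0 < t * (1 - t) := mul_pos ht0 (sub_pos.2 ht1)
  have hba : 0 < (b - a) ^ 2 := pow_pos (sub_pos.2 hab) 2
  simp only [integral_mu2 ht0.le ht1.le]
  rw [← sub_pos, ← sub_pos (b := (_ : ℝ) ^ 2)]
  constructor
  · have : (t * a + (1 - t) * b) * (t * (1 / a) + (1 - t) * (1 / b)) - 1
        = t * (1 - t) * (b - a) ^ 2 / (a * b) := by
      field_simp
      ring
    rw [this]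
    positivity
  · have : t * (1 / a ^ 2) + (1 - t) * (1 / b ^ 2) - (t * (1 / a) + (1 - t) * (1 / b)) ^ 2
        = t * (1 - t) * (b - a) ^ 2 / (a * b) ^ 2 := by
      field_simp
      ring
    rw [this]
    positivity

/-- A two-atomic measure with prescribed first and inverse first moments may have inverse second
moment arbitrarily close to the lower bound given by Jensen's inequality. -/
theorem exists_isTwoAtom_moments {m r w : ℝ} (hm : 0 < m) (hr : 1 < r) (hw : 0 < w) :
    ∃ μ : Measure ℝ, IsTwoAtom μ ∧ ∫ s, s ∂μ = m ∧ ∫ s, 1 / s ∂μ = r / m ∧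
      ∫ s, 1 / s ^ 2 ∂μ ≤ (1 + w) * (r / m) ^ 2 := by
  have hr1 : 0 < r - 1 := sub_pos.2 hr
  have hr0 : 0 < r := by linarith
  have hden : 0 < r * w + (r - 1) := by positivity
  obtain ⟨u, hu⟩ : ∃ u, u = (r - 1) * (1 + w) / (r * w + (r - 1)) := ⟨_, rfl⟩
  have hu0 : 0 < u := by rw [hu]; positivity
  have hu1 : u < 1 := by rw [hu, div_lt_one hden]; linarith
  have hrel : (r - 1) * (1 + w - u) = r * u * w := by
    have := (eq_div_iff hden.ne').1 hu
    linarith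
  have hv : 0 < 1 - u := sub_pos.2 hu1
  have hvne : 1 - u ≠ 0 := hv.ne'
  have hw1 : 0 < 1 + w := by positivity
  have huw : 0 < u + w := by positivity
  have ht1 : u / (u + w) < 1 := by rw [div_lt_one huw]; linarith
  have hlt : m / (r * (1 + w)) < m / (r * (1 - u)) := by
    apply div_lt_div_of_pos_left hm (by positivity)
    exact mul_lt_mul_of_pos_left (by linarith) hr0
  refine ⟨mu2 (u / (u + w)) (m / (r * (1 + w))) (m / (r * (1 - u))),
    ⟨_, _, _, by positivity, ht1, by positivity, hlt, rfl⟩, ?_, ?_, ?_⟩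
  · rw [integral_mu2 (by positivity) ht1.le]
    field_simp
    linear_combination -(u + w) * hrel
  · rw [integral_mu2 (by positivity) ht1.le]
    field_simp
    ring
  · rw [integral_mu2 (by positivity) ht1.le]
    have : u / (u + w) * (1 / (m / (r * (1 + w))) ^ 2)
        + (1 - u / (u + w)) * (1 / (m / (r * (1 - u))) ^ 2) = (1 + u * w) * (r / m) ^ 2 := by
      field_simp
      ring
    rw [this]
    gcongr
    nlinarith

theorem exists_measure_moments {m r w : ℝ} (hm : 0 < m) (hr : 1 ≤ r) (hw : 0 ≤ w)
    (hrw : 1 < r → 0 < w) :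
    ∃ μ : Measure ℝ, (IsOneAtom μ ∨ IsTwoAtom μ) ∧ ∫ s, s ∂μ = m ∧ ∫ s, 1 / s ∂μ = r / m ∧
      ∫ s, 1 / s ^ 2 ∂μ ≤ (1 + w) * (r / m) ^ 2 := by
  rcases hr.eq_or_lt with rfl | h
  · refine ⟨Measure.dirac m, Or.inl ⟨m, hm, rfl⟩, integral_dirac _ _, integral_dirac _ _, ?_⟩
    rw [integral_dirac, one_div_pow]
    exact le_mul_of_one_le_left (by positivity) (by linarith)
  · obtain ⟨μ, h1, h2⟩ := exists_isTwoAtom_moments hm h (hrw h)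
    exact ⟨μ, Or.inr h1, h2⟩

theorem exists_ratios_of_measures {ι : Type*} [Fintype ι] {C : ℝ} {l1 l2 : ι → ℝ}
    (hl1 : ∀ i, 0 < l1 i) (hl2 : ∀ i, 0 < l2 i) {μ : ι → Measure ℝ}
    (hμ : ∀ i, IsOneAtom (μ i) ∨ IsTwoAtom (μ i))
    (hmean : ∀ i, ∫ s, s ∂(μ i) = (l2 i) ^ 2)
    (hinv : (∑ i, (l1 i) ^ 2 * ∫ s, 1 / s ∂(μ i)) = 1)
    (hinv2 : (∑ i, (l1 i) ^ 2 * ∫ s, 1 / s ^ 2 ∂(μ i)) ≤ C) :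
    ∃ r : ι → ℝ, (∀ i, 1 ≤ r i) ∧
      (∑ i, r i * (l1 i) ^ 2 / (l2 i) ^ 2) = 1 ∧
      ((∀ i, r i = 1) → (∑ i, (r i) ^ 2 * (l1 i) ^ 2 / (l2 i) ^ 4) ≤ C) ∧
      ((∃ i, 1 < r i) → (∑ i, (r i) ^ 2 * (l1 i) ^ 2 / (l2 i) ^ 4) < C) ∧
      (∀ i, (r i = 1 ↔ IsOneAtom (μ i)) ∧ (1 < r i ↔ IsTwoAtom (μ i))) := by
  let r : ι → ℝ := fun i => (l2 i) ^ 2 * ∫ s, 1 / s ∂(μ i)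
  have hone (i) (h : IsOneAtom (μ i)) : r i = 1 := by simpa only [hmean] using h.moments.1
  have htwo (i) (h : IsTwoAtom (μ i)) : 1 < r i := by simpa only [hmean] using h.moments.1
  have hiff (i) : (r i = 1 ↔ IsOneAtom (μ i)) ∧ (1 < r i ↔ IsTwoAtom (μ i)) :=
    ⟨⟨fun h => (hμ i).resolve_right fun h' => (htwo i h').ne' h, hone i⟩,
      ⟨fun h => (hμ i).resolve_left fun h' => h.ne' (hone i h'), htwo i⟩⟩
  have hterm (i) : (r i) ^ 2 * (l1 i) ^ 2 / (l2 i) ^ 4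
      = (l1 i) ^ 2 * (∫ s, 1 / s ∂(μ i)) ^ 2 := by
    have := (hl2 i).ne'
    simp only [r]
    field_simp
  have hle (i) : (r i) ^ 2 * (l1 i) ^ 2 / (l2 i) ^ 4 ≤ (l1 i) ^ 2 * ∫ s, 1 / s ^ 2 ∂(μ i) := by
    rw [hterm]
    refine mul_le_mul_of_nonneg_left ?_ (sq_nonneg _)
    rcases hμ i with h | h
    · exact h.moments.2.ge
    · exact h.moments.2.le
  refine ⟨r, fun i => (hμ i).elim (fun h => (hone i h).ge) fun h => (htwo i h).le, ?_,
    fun _ => (Finset.sum_le_sum fun i _ => hle i).trans hinv2, ?_, hiff⟩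
  · rw [← hinv]
    refine Finset.sum_congr rfl fun i _ => ?_
    have := (hl2 i).ne'
    simp only [r]
    field_simp
  · rintro ⟨j, hj⟩
    refine (Finset.sum_lt_sum (fun i _ => hle i) ⟨j, Finset.mem_univ j, ?_⟩).trans_le hinv2
    rw [hterm]
    exact mul_lt_mul_of_pos_left ((hiff j).2.1 hj).moments.2 (pow_pos (hl1 j) 2)

theorem exists_measures_of_ratios {ι : Type*} [Fintype ι] {C : ℝ} {l1 l2 : ι → ℝ}
    (hl1 : ∀ i, 0 < l1 i) (hl2 : ∀ i, 0 < l2 i) {r : ι → ℝ} (hr : ∀ i, 1 ≤ r i)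
    (hsum : (∑ i, r i * (l1 i) ^ 2 / (l2 i) ^ 2) = 1)
    (hle : (∀ i, r i = 1) → (∑ i, (r i) ^ 2 * (l1 i) ^ 2 / (l2 i) ^ 4) ≤ C)
    (hlt : (∃ i, 1 < r i) → (∑ i, (r i) ^ 2 * (l1 i) ^ 2 / (l2 i) ^ 4) < C) :
    ∃ μ : ι → Measure ℝ, (∀ i, IsOneAtom (μ i) ∨ IsTwoAtom (μ i)) ∧
      (∀ i, ∫ s, s ∂(μ i) = (l2 i) ^ 2) ∧
      (∑ i, (l1 i) ^ 2 * ∫ s, 1 / s ∂(μ i)) = 1 ∧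
      (∑ i, (l1 i) ^ 2 * ∫ s, 1 / s ^ 2 ∂(μ i)) ≤ C := by
  set S := ∑ i, (r i) ^ 2 * (l1 i) ^ 2 / (l2 i) ^ 4 with hS
  have hne : (Finset.univ : Finset ι).Nonempty := by
    by_contra h
    simp [Finset.not_nonempty_iff_eq_empty.1 h] at hsum
  have hS0 : 0 < S := Finset.sum_pos (fun i _ => by
    have := hl1 i
    have := hl2 i
    have := zero_lt_one.trans_le (hr i)
    positivity) hne
  have hSC : S ≤ C := by
    by_cases h : ∃ i, 1 < r i
    · exact (hlt h).le
    · exact hle fun i => le_antisymm (not_lt.1 fun hi => h ⟨i, hi⟩) (hr i)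
  choose μ hμ hmean hinv hinv2 using fun i =>
    exists_measure_moments (w := (C - S) / S) (pow_pos (hl2 i) 2) (hr i)
      (div_nonneg (sub_nonneg.2 hSC) hS0.le) fun h => div_pos (sub_pos.2 (hlt ⟨i, h⟩)) hS0
  refine ⟨μ, hμ, hmean, ?_, ?_⟩
  · refine Eq.trans (Finset.sum_congr rfl fun i _ => ?_) hsum
    rw [hinv]
    ring
  · calc (∑ i, (l1 i) ^ 2 * ∫ s, 1 / s ^ 2 ∂(μ i))
        ≤ ∑ i, (1 + (C - S) / S) * ((r i) ^ 2 * (l1 i) ^ 2 / (l2 i) ^ 4) := by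
          refine Finset.sum_le_sum fun i _ => ?_
          refine (mul_le_mul_of_nonneg_left (hinv2 i) (sq_nonneg _)).trans_eq ?_
          have := (hl2 i).ne'
          field_simp
      _ = C := by
          rw [← Finset.mul_sum, ← hS]
          field_simp
          ring

theorem stmt15 (η : ℕ) (hη : 2 ≤ η) (lam0 : ℝ) (hlam0 : 0 < lam0)
    (l1 l2 : Fin η → ℝ) (hl1 : ∀ i, 0 < l1 i) (hl2 : ∀ i, 0 < l2 i) :
    ((∃ μ : Fin η → Measure ℝ,
        (∀ i, IsOneAtom (μ i) ∨ IsTwoAtom (μ i)) ∧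
        (∀ i, ∫ s, s ∂(μ i) = (l2 i)^2) ∧
        (∑ i, (l1 i)^2 * ∫ s, 1 / s ∂(μ i)) = 1 ∧
        (∑ i, (l1 i)^2 * ∫ s, 1 / s^2 ∂(μ i)) ≤ 1 / lam0^2) ↔
      (∃ r : Fin η → ℝ, (∀ i, 1 ≤ r i) ∧
        (∑ i, r i * (l1 i)^2 / (l2 i)^2) = 1 ∧
        ((∀ i, r i = 1) → (∑ i, (r i)^2 * (l1 i)^2 / (l2 i)^4) ≤ 1 / lam0^2) ∧
        ((∃ i, 1 < r i) → (∑ i, (r i)^2 * (l1 i)^2 / (l2 i)^4) < 1 / lam0^2))) ∧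
    (∀ μ : Fin η → Measure ℝ,
      (∀ i, IsOneAtom (μ i) ∨ IsTwoAtom (μ i)) →
      (∀ i, ∫ s, s ∂(μ i) = (l2 i)^2) →
      (∑ i, (l1 i)^2 * ∫ s, 1 / s ∂(μ i)) = 1 →
      (∑ i, (l1 i)^2 * ∫ s, 1 / s^2 ∂(μ i)) ≤ 1 / lam0^2 →
      ∃ r : Fin η → ℝ, (∀ i, 1 ≤ r i) ∧
        (∑ i, r i * (l1 i)^2 / (l2 i)^2) = 1 ∧
        ((∀ i, r i = 1) → (∑ i, (r i)^2 * (l1 i)^2 / (l2 i)^4) ≤ 1 / lam0^2) ∧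
        ((∃ i, 1 < r i) → (∑ i, (r i)^2 * (l1 i)^2 / (l2 i)^4) < 1 / lam0^2) ∧
        (∀ i, (r i = 1 ↔ IsOneAtom (μ i)) ∧ (1 < r i ↔ IsTwoAtom (μ i)))) := by
  refine ⟨⟨?_, ?_⟩, fun μ hμ hmean hinv hinv2 =>
    exists_ratios_of_measures hl1 hl2 hμ hmean hinv hinv2⟩
  · rintro ⟨μ, hμ, hmean, hinv, hinv2⟩
    obtain ⟨r, hr, hsum, hle, hlt, -⟩ := exists_ratios_of_measures hl1 hl2 hμ hmean hinv hinv2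
    exact ⟨r, hr, hsum, hle, hlt⟩
  · rintro ⟨r, hr, hsum, hle, hlt⟩
    exact exists_measures_of_ratios hl1 hl2 hr hsum hle hlt
end
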